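/- arXiv:1011.1161 — 3 statements merged into one kernel-verified Lean document; each statement's English description precedes it below -/
import Mathlib

section
/- Let r_1, ..., r_n be nonnegative reals and w_1, ..., w_n be positive reals such that the sequence r_i/w_i is non-increasing in i, and let w = ∑_{i=1}^n w_i. Then for every k with 1 ≤ k ≤ n+1: ∑_{i<k} r_i · (1 - (1/w)·∑_{j<i} w_j) ≥ (∑_{i<k} r_i)(∑_{i<k} w_i)/(2w) + ∑_{i<k} r_i·w_i/(2w) + (∑_{i<k} r_i)·(∑_{j≥k} w_j)/w. -/
open Finset

/-- If the ratios `r i / w i` are non-increasing, then the full double sum of `r i * w j` dominates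
twice its part below the diagonal plus its diagonal. -/
theorem two_mul_sum_mul_sum_Ico_add_le
    (n : ℕ) (r w : ℕ → ℝ)
    (hw : ∀ i ∈ Finset.Icc 1 n, 0 < w i)
    (hratio : ∀ i j, 1 ≤ i → i ≤ j → j ≤ n → r j / w j ≤ r i / w i)
    (k : ℕ) (hk1 : 1 ≤ k) (hk2 : k ≤ n + 1) :
    2 * ∑ i ∈ Finset.Ico 1 k, r i * ∑ j ∈ Finset.Ico 1 i, w j
        + ∑ i ∈ Finset.Ico 1 k, r i * w i ≤
      (∑ i ∈ Finset.Ico 1 k, r i) * ∑ i ∈ Finset.Ico 1 k, w i := by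
  induction k, hk1 using Nat.le_induction with
  | base => simp
  | succ k hk ih =>
    have hcross : r k * ∑ i ∈ Finset.Ico 1 k, w i ≤ (∑ i ∈ Finset.Ico 1 k, r i) * w k := by
      rw [Finset.mul_sum, Finset.sum_mul]
      refine Finset.sum_le_sum fun i hi => ?_
      obtain ⟨hi1, hik⟩ := Finset.mem_Ico.mp hi
      have hwi : 0 < w i := hw i (Finset.mem_Icc.mpr ⟨hi1, by omega⟩)
      have hwk : 0 < w k := hw k (Finset.mem_Icc.mpr ⟨hk, by omega⟩)
      exact (div_le_div_iff₀ hwk hwi).mp (hratio i k hi1 hik.le (by omega))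
    simp only [Finset.sum_Ico_succ_top hk]
    linarith [ih (by omega)]

/-- **Chain inequality (Lemma `concavechain`).** If `r i ≥ 0`, `w i > 0` for
`1 ≤ i ≤ n`, the ratios `r i / w i` are non-increasing, and `w = ∑_{i=1}^n w i`,
then for every `1 ≤ k ≤ n + 1`:
`∑_{i<k} r i (1 - (1/w) ∑_{j<i} w j) ≥ (∑_{i<k} r i)(∑_{i<k} w i)/(2w)
  + ∑_{i<k} r i w i / (2w) + (∑_{i<k} r i)(∑_{j≥k} w j)/w`. -/
theorem chain_inequality
    (n : ℕ) (r w : ℕ → ℝ)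
    (hr : ∀ i ∈ Finset.Icc 1 n, 0 ≤ r i)
    (hw : ∀ i ∈ Finset.Icc 1 n, 0 < w i)
    (hratio : ∀ i j, 1 ≤ i → i ≤ j → j ≤ n → r j / w j ≤ r i / w i)
    (W : ℝ) (hW : W = ∑ i ∈ Finset.Icc 1 n, w i)
    (k : ℕ) (hk1 : 1 ≤ k) (hk2 : k ≤ n + 1) :
    ∑ i ∈ Finset.Ico 1 k, r i * (1 - (1 / W) * ∑ j ∈ Finset.Ico 1 i, w j) ≥
      (∑ i ∈ Finset.Ico 1 k, r i) * (∑ i ∈ Finset.Ico 1 k, w i) / (2 * W)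
        + (∑ i ∈ Finset.Ico 1 k, r i * w i) / (2 * W)
        + (∑ i ∈ Finset.Ico 1 k, r i) * (∑ j ∈ Finset.Icc k n, w j) / W := by
  have hcore := two_mul_sum_mul_sum_Ico_add_le n r w hw hratio k hk1 hk2
  rcases Nat.eq_zero_or_pos n with rfl | hn
  · obtain rfl : k = 1 := by omega
    simp
  have hWpos : 0 < W := by
    rw [hW]
    exact Finset.sum_pos hw ⟨1, Finset.mem_Icc.mpr ⟨le_rfl, hn⟩⟩
  have htail : ∑ j ∈ Finset.Icc k n, w j = W - ∑ i ∈ Finset.Ico 1 k, w i := by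
    have hsplit := Finset.sum_Ico_consecutive w hk1 hk2
    simp only [Finset.Ico_add_one_right_eq_Icc] at hsplit
    linarith
  have hleft : ∑ i ∈ Finset.Ico 1 k, r i * (1 - (1 / W) * ∑ j ∈ Finset.Ico 1 i, w j) =
      ∑ i ∈ Finset.Ico 1 k, r i - (∑ i ∈ Finset.Ico 1 k, r i * ∑ j ∈ Finset.Ico 1 i, w j) / W := by
    rw [Finset.sum_div, ← Finset.sum_sub_distrib]
    exact Finset.sum_congr rfl fun i _ => by ring
  rw [hleft, htail, ge_iff_le, ← sub_nonneg]
  have hdiff : ∀ R A S D : ℝ,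
      R - S / W - (R * A / (2 * W) + D / (2 * W) + R * (W - A) / W) =
        (R * A - (2 * S + D)) / (2 * W) := by
    intro R A S D
    field_simp
    ring
  rw [hdiff]
  exact div_nonneg (sub_nonneg.mpr hcore) (by positivity)
end

section
/- Let r_1, ..., r_n be nonnegative reals and w_1, ..., w_n be positive reals such that the sequence r_i/w_i is non-increasing in i, and let w = ∑_{i=1}^n w_i. Then ∑_{i=1}^n r_i · (1 - (1/w)·∑_{j<i} w_j) ≥ (1/2)·∑_{i=1}^n r_i. -/
open Finset

/-- If `r j * w i ≤ r i * w j` for `i ≤ j`, then a Chebyshev-type bound holds for the sum of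
the `r i` weighted by the partial sums of `w`. -/
theorem two_mul_sum_mul_partial_sum_le (n : ℕ) (r w : ℕ → ℝ)
    (hr : ∀ i ∈ Finset.Icc 1 n, 0 ≤ r i) (hw : ∀ i ∈ Finset.Icc 1 n, 0 ≤ w i)
    (hcross : ∀ i j, 1 ≤ i → i ≤ j → j ≤ n → r j * w i ≤ r i * w j) :
    2 * ∑ i ∈ Finset.Icc 1 n, r i * ∑ j ∈ Finset.Ico 1 i, w j ≤
      (∑ i ∈ Finset.Icc 1 n, w i) * ∑ i ∈ Finset.Icc 1 n, r i := by
  induction n with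
  | zero => simp
  | succ m ih =>
    have hsub : Finset.Icc 1 m ⊆ Finset.Icc 1 (m + 1) := Finset.Icc_subset_Icc_right m.le_succ
    have ih' := ih (fun i hi => hr i (hsub hi)) (fun i hi => hw i (hsub hi))
      (fun i j hi hij hj => hcross i j hi hij (hj.trans m.le_succ))
    have hlast : m + 1 ∈ Finset.Icc 1 (m + 1) := by simp
    have hprod : 0 ≤ w (m + 1) * r (m + 1) := mul_nonneg (hw _ hlast) (hr _ hlast)
    have hstep : r (m + 1) * ∑ j ∈ Finset.Icc 1 m, w j ≤
        (∑ j ∈ Finset.Icc 1 m, r j) * w (m + 1) := by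
      rw [Finset.mul_sum, Finset.sum_mul]
      refine Finset.sum_le_sum fun j hj => ?_
      rw [Finset.mem_Icc] at hj
      exact hcross j (m + 1) hj.1 (hj.2.trans m.le_succ) le_rfl
    have hIco : Finset.Ico 1 (m + 1) = Finset.Icc 1 m := by
      ext
      simp
    simp only [Finset.sum_Icc_succ_top (Nat.le_add_left 1 m), hIco]
    linarith

/-- The `k = n + 1` instance of the chain inequality: if `r i ≥ 0`, `w i > 0`
with `r i / w i` non-increasing and `w = ∑_{i=1}^n w i`, then
`∑_{i=1}^n r i (1 - (1/w) ∑_{j<i} w j) ≥ (1/2) ∑_{i=1}^n r i`. -/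
theorem chain_inequality_half
    (n : ℕ) (r w : ℕ → ℝ)
    (hr : ∀ i ∈ Finset.Icc 1 n, 0 ≤ r i)
    (hw : ∀ i ∈ Finset.Icc 1 n, 0 < w i)
    (hratio : ∀ i j, 1 ≤ i → i ≤ j → j ≤ n → r j / w j ≤ r i / w i)
    (W : ℝ) (hW : W = ∑ i ∈ Finset.Icc 1 n, w i) :
    ∑ i ∈ Finset.Icc 1 n, r i * (1 - (1 / W) * ∑ j ∈ Finset.Ico 1 i, w j) ≥
      (1 / 2) * ∑ i ∈ Finset.Icc 1 n, r i := by
  rcases n.eq_zero_or_pos with rfl | hn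
  · simp
  have hWpos : 0 < W := hW ▸ Finset.sum_pos hw (Finset.nonempty_Icc.mpr hn)
  have hmain := two_mul_sum_mul_partial_sum_le n r w hr (fun i hi => (hw i hi).le)
    fun i j hi hij hj => (div_le_div_iff₀ (hw j (Finset.mem_Icc.mpr ⟨hi.trans hij, hj⟩))
      (hw i (Finset.mem_Icc.mpr ⟨hi, hij.trans hj⟩))).mp (hratio i j hi hij hj)
  rw [← hW] at hmain
  have hexpand : ∑ i ∈ Finset.Icc 1 n, r i * (1 - (1 / W) * ∑ j ∈ Finset.Ico 1 i, w j) =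
      ∑ i ∈ Finset.Icc 1 n, r i -
        (∑ i ∈ Finset.Icc 1 n, r i * ∑ j ∈ Finset.Ico 1 i, w j) / W := by
    rw [Finset.sum_div, ← Finset.sum_sub_distrib]
    exact Finset.sum_congr rfl fun i _ => by ring
  have hdiv : (∑ i ∈ Finset.Icc 1 n, r i * ∑ j ∈ Finset.Ico 1 i, w j) / W ≤
      (1 / 2) * ∑ i ∈ Finset.Icc 1 n, r i := by
    rw [div_le_iff₀ hWpos]
    linarith
  rw [hexpand]
  linarith
end

section
/- Analysis of the sequential rounding scheme: Let T > 0 be a real number, let T_1, ..., T_n be nonnegative integrable random variables on a probability space with E[T_j] = w_j, where w_1, ..., w_n are positive reals with ∑_{j=1}^n w_j = T, and let r_1, ..., r_n be nonnegative reals such that r_i/w_i is non-increasing in i. Then E[∑_{i=1}^n r_i · (1 - (1/T)·min(T, ∑_{j<i} T_j))] ≥ (1/2)·∑_{i=1}^n r_i. -/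
open MeasureTheory Finset

/-- If `r j / w j` is non-increasing, then pairing each `r i` with the weight preceding it
captures at most half of the product of the totals. -/
lemma two_mul_sum_mul_sum_Ico_le (r w : ℕ → ℝ) (n : ℕ)
    (hr : ∀ i ∈ Finset.Icc 1 n, 0 ≤ r i) (hw : ∀ i ∈ Finset.Icc 1 n, 0 < w i)
    (hratio : ∀ i j, 1 ≤ i → i ≤ j → j ≤ n → r j / w j ≤ r i / w i) :
    2 * ∑ i ∈ Finset.Icc 1 n, r i * ∑ j ∈ Finset.Ico 1 i, w j ≤
      (∑ j ∈ Finset.Icc 1 n, w j) * ∑ i ∈ Finset.Icc 1 n, r i := by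
  induction n with
  | zero => simp
  | succ m ih =>
    have hsub : ∀ i ∈ Finset.Icc 1 m, i ∈ Finset.Icc 1 (m + 1) := fun i hi =>
      Finset.Icc_subset_Icc_right m.le_succ hi
    have hlast : m + 1 ∈ Finset.Icc 1 (m + 1) := by simp
    have ih' := ih (fun i hi => hr i (hsub i hi)) (fun i hi => hw i (hsub i hi))
      (fun i j hi hij hj => hratio i j hi hij (hj.trans m.le_succ))
    have hcross : r (m + 1) * ∑ j ∈ Finset.Icc 1 m, w j ≤
        w (m + 1) * ∑ j ∈ Finset.Icc 1 m, r j := by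
      rw [Finset.mul_sum, Finset.mul_sum]
      refine Finset.sum_le_sum fun j hj => ?_
      obtain ⟨h1, h2⟩ := Finset.mem_Icc.1 hj
      have h := hratio j (m + 1) h1 (h2.trans m.le_succ) le_rfl
      rw [div_le_div_iff₀ (hw _ hlast) (hw j (hsub j hj))] at h
      linarith
    have hIco : Finset.Ico 1 (m + 1) = Finset.Icc 1 m := by
      ext j
      simp only [Finset.mem_Ico, Finset.mem_Icc]
      omega
    have hnn : 0 ≤ w (m + 1) * r (m + 1) := mul_nonneg (hw _ hlast).le (hr _ hlast)
    simp only [Finset.sum_Icc_succ_top (Nat.le_add_left 1 m), hIco]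
    linarith

/-- **Analysis of the sequential rounding scheme.** If `T_1, ..., T_n` are
nonnegative integrable random variables with `E[T_j] = w j`, where the `w j > 0`
sum to `T > 0`, and `r i ≥ 0` with `r i / w i` non-increasing, then
`E[∑_i r i (1 - (1/T) min(T, ∑_{j<i} T_j))] ≥ (1/2) ∑_i r i`. -/
theorem rounding_scheme_analysis
    {Ω : Type*} [MeasurableSpace Ω] {μ : Measure Ω} [IsProbabilityMeasure μ]
    (n : ℕ) (T : ℝ) (hT : 0 < T)
    (Tj : ℕ → Ω → ℝ)
    (hTj_nonneg : ∀ j ∈ Finset.Icc 1 n, 0 ≤ᵐ[μ] Tj j)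
    (hTj_int : ∀ j ∈ Finset.Icc 1 n, Integrable (Tj j) μ)
    (r w : ℕ → ℝ)
    (hmean : ∀ j ∈ Finset.Icc 1 n, ∫ ω, Tj j ω ∂μ = w j)
    (hr : ∀ i ∈ Finset.Icc 1 n, 0 ≤ r i)
    (hw : ∀ i ∈ Finset.Icc 1 n, 0 < w i)
    (hsum : ∑ j ∈ Finset.Icc 1 n, w j = T)
    (hratio : ∀ i j, 1 ≤ i → i ≤ j → j ≤ n → r j / w j ≤ r i / w i) :
    ∫ ω, (∑ i ∈ Finset.Icc 1 n,
        r i * (1 - (1 / T) * min T (∑ j ∈ Finset.Ico 1 i, Tj j ω))) ∂μ ≥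
      (1 / 2) * ∑ i ∈ Finset.Icc 1 n, r i := by
  have hmem : ∀ i ∈ Finset.Icc 1 n, ∀ j ∈ Finset.Ico 1 i, j ∈ Finset.Icc 1 n := by
    intro i hi j hj
    simp only [Finset.mem_Icc, Finset.mem_Ico] at hi hj ⊢
    omega
  have hS : ∀ i ∈ Finset.Icc 1 n, Integrable (fun ω => ∑ j ∈ Finset.Ico 1 i, Tj j ω) μ :=
    fun i hi => integrable_finsetSum _ fun j hj => hTj_int j (hmem i hi j hj)
  have hmin : ∀ i ∈ Finset.Icc 1 n,
      Integrable (fun ω => min T (∑ j ∈ Finset.Ico 1 i, Tj j ω)) μ :=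
    fun i hi => (integrable_const T).inf (hS i hi)
  have hmin_le : ∀ i ∈ Finset.Icc 1 n,
      ∫ ω, min T (∑ j ∈ Finset.Ico 1 i, Tj j ω) ∂μ ≤ ∑ j ∈ Finset.Ico 1 i, w j := by
    intro i hi
    calc ∫ ω, min T (∑ j ∈ Finset.Ico 1 i, Tj j ω) ∂μ
        ≤ ∫ ω, ∑ j ∈ Finset.Ico 1 i, Tj j ω ∂μ :=
          integral_mono (hmin i hi) (hS i hi) fun ω => min_le_right _ _
      _ = ∑ j ∈ Finset.Ico 1 i, w j := by
          rw [integral_finsetSum _ fun j hj => hTj_int j (hmem i hi j hj)]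
          exact Finset.sum_congr rfl fun j hj => hmean j (hmem i hi j hj)
  have hint : ∀ i ∈ Finset.Icc 1 n, Integrable
      (fun ω => r i * (1 - (1 / T) * min T (∑ j ∈ Finset.Ico 1 i, Tj j ω))) μ :=
    fun i hi => ((integrable_const (1 : ℝ)).sub ((hmin i hi).const_mul (1 / T))).const_mul (r i)
  rw [integral_finsetSum _ hint]
  have hterm : ∀ i ∈ Finset.Icc 1 n, r i * (1 - (1 / T) * ∑ j ∈ Finset.Ico 1 i, w j) ≤
      ∫ ω, r i * (1 - (1 / T) * min T (∑ j ∈ Finset.Ico 1 i, Tj j ω)) ∂μ := by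
    intro i hi
    rw [integral_const_mul, integral_sub (integrable_const _) ((hmin i hi).const_mul _),
      integral_const_mul, integral_const, probReal_univ, one_smul]
    have := hr i hi
    have := hmin_le i hi
    gcongr
  refine ge_iff_le.2 (le_trans ?_ (Finset.sum_le_sum hterm))
  have hkey := two_mul_sum_mul_sum_Ico_le r w n hr hw hratio
  rw [hsum] at hkey
  have hexpand : ∑ i ∈ Finset.Icc 1 n, r i * (1 - (1 / T) * ∑ j ∈ Finset.Ico 1 i, w j) =
      ∑ i ∈ Finset.Icc 1 n, r i -
        (∑ i ∈ Finset.Icc 1 n, r i * ∑ j ∈ Finset.Ico 1 i, w j) / T := by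
    rw [Finset.sum_div, ← Finset.sum_sub_distrib]
    exact Finset.sum_congr rfl fun i _ => by ring
  have hdiv : (∑ i ∈ Finset.Icc 1 n, r i * ∑ j ∈ Finset.Ico 1 i, w j) / T ≤
      (1 / 2) * ∑ i ∈ Finset.Icc 1 n, r i := by
    rw [div_le_iff₀ hT]
    linarith
  rw [hexpand]
  linarith
end
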